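/- arXiv:1405.2323 — 2 statements merged into one kernel-verified Lean document; each statement's English description precedes it below -/
import Mathlib

section
/- Let p₁, p₂ be polynomials with complex coefficients such that p₂ has no zeros on the closed unit disk, and suppose |p₁(ζ)| ≤ |p₂(ζ)| for all ζ on the unit circle, with strict inequality for at least one ζ. Then there exists a polynomial p with no zeros in the open unit disk such that |p(ζ)|² = |p₂(ζ)|² − |p₁(ζ)|² for all ζ on the unit circle. -/
open Complex Polynomial

open scoped ComplexConjugate

/-- The reciprocal polynomial `z ^ N * conj (f (1 / conj z))`. -/
noncomputable def conjReflect (N : ℕ) (f : ℂ[X]) : ℂ[X] :=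
  (f.map (starRingEnd ℂ)).reflect N

theorem eval_conjReflect_inv_conj {N : ℕ} {f : ℂ[X]} (hN : f.natDegree ≤ N) {x : ℂ}
    (hx : x ≠ 0) :
    (conjReflect N f).eval (conj x)⁻¹ * conj x ^ N = conj (f.eval x) := by
  have hcx : conj x ≠ 0 := (_root_.map_ne_zero _).2 hx
  let u : ℂˣ := Units.mk0 _ hcx
  let _ : Invertible (conj x) := u.invertible
  have h := eval₂_reflect_mul_pow (RingHom.id ℂ) (conj x) N (f.map (starRingEnd ℂ))
    (natDegree_map_le.trans hN)
  rw [invOf_eq_inv] at h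
  simpa [conjReflect, eval₂_id, eval_map, eval₂_hom] using h

theorem conj_mul_self_of_norm_eq_one {ζ : ℂ} (hζ : ‖ζ‖ = 1) : conj ζ * ζ = 1 := by
  rw [Complex.conj_mul', hζ]; norm_num

theorem eval_conjReflect_of_norm_eq_one {N : ℕ} {f : ℂ[X]} (hN : f.natDegree ≤ N) {ζ : ℂ}
    (hζ : ‖ζ‖ = 1) :
    (conjReflect N f).eval ζ = ζ ^ N * conj (f.eval ζ) := by
  have h0 : ζ ≠ 0 := by rintro rfl; simp at hζ
  have h := conj_mul_self_of_norm_eq_one hζ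
  have h1 := eval_conjReflect_inv_conj hN h0
  rw [inv_eq_of_mul_eq_one_right h] at h1
  rw [← h1, mul_left_comm, ← mul_pow, mul_comm ζ, h, one_pow, mul_one]

theorem infinite_norm_eq_one : {ζ : ℂ | ‖ζ‖ = 1}.Infinite := by
  have h : {ζ : ℂ | ‖ζ‖ = 1} = Metric.sphere 0 1 := by ext; simp
  rw [h]
  refine (isPreconnected_sphere (by simp [Complex.rank_real_complex]) 0 1).infinite_of_nontrivial
    ⟨1, by simp, -1, by simp, by norm_num⟩

/-- If `ζ ^ (a - b) * Q ζ` is nonnegative on the unit circle, the roots of `Q` are symmetric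
about it. -/
theorem isRoot_inv_conj {Q : ℂ[X]} {a b : ℕ}
    (hQ : ∀ ζ : ℂ, ‖ζ‖ = 1 → ζ ^ a * Q.eval ζ = ζ ^ b * ‖Q.eval ζ‖) {r : ℂ}
    (hr : r ≠ 0) (hroot : Q.eval r = 0) : Q.eval (conj r)⁻¹ = 0 := by
  have hpoly : X ^ (2 * b) * conjReflect Q.natDegree Q = X ^ (Q.natDegree + 2 * a) * Q := by
    refine eq_of_infinite_eval_eq _ _ (infinite_norm_eq_one.mono fun ζ (hζ : ‖ζ‖ = 1) => ?_)
    have h := conj_mul_self_of_norm_eq_one hζ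
    have h1 := hQ ζ hζ
    have h2 := congrArg conj h1
    simp only [map_mul, map_pow, conj_ofReal] at h2
    have ha : conj ζ ^ a * ζ ^ a = 1 := by rw [← mul_pow, h, one_pow]
    have hb : conj ζ ^ b * ζ ^ b = 1 := by rw [← mul_pow, h, one_pow]
    have key : ζ ^ (2 * b) * conj (Q.eval ζ) = ζ ^ (2 * a) * Q.eval ζ := by
      linear_combination (-ζ ^ a) * h1 + ζ ^ (2 * b) * ζ ^ a * h2
        - ζ ^ (2 * b) * conj (Q.eval ζ) * ha + ζ ^ a * ζ ^ b * ‖Q.eval ζ‖ * hb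
    simp only [Set.mem_ofPred_eq, eval_mul, eval_pow, eval_X]
    rw [eval_conjReflect_of_norm_eq_one le_rfl hζ]
    linear_combination ζ ^ Q.natDegree * key
  have hcr : conj r ≠ 0 := (_root_.map_ne_zero _).2 hr
  have h1 := eval_conjReflect_inv_conj (le_refl Q.natDegree) hr
  rw [hroot, map_zero, mul_eq_zero, or_iff_left (pow_ne_zero _ hcr)] at h1
  have h2 := congrArg (eval (conj r)⁻¹) hpoly
  rw [eval_mul, h1, mul_zero, eval_mul, eval_pow, eval_X, eq_comm, mul_eq_zero] at h2
  exact h2.resolve_left (pow_ne_zero _ (inv_ne_zero hcr))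

/-- If `ζ ^ (a - b) * Q ζ` is nonnegative on the unit circle, then `Q` has no simple root there. -/
theorem eval_derivative_eq_zero {Q : ℂ[X]} {a b : ℕ}
    (hQ : ∀ ζ : ℂ, ‖ζ‖ = 1 → ζ ^ a * Q.eval ζ = ζ ^ b * ‖Q.eval ζ‖) {r : ℂ}
    (hr : ‖r‖ = 1) (hroot : Q.eval r = 0) : Q.derivative.eval r = 0 := by
  obtain ⟨t, rfl⟩ := (Complex.norm_eq_one_iff r).1 hr
  let e : ℝ → ℂ := fun s => Complex.exp (s * I)
  let u : ℝ → ℂ := fun s => Complex.exp (s * (((a : ℂ) - b) * I))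
  have he : HasDerivAt e (e t * I) t := by
    simpa [e] using ((hasDerivAt_id t).ofReal_comp.mul_const I).cexp
  have hu : HasDerivAt u (u t * (((a : ℂ) - b) * I)) t := by
    simpa [u] using ((hasDerivAt_id t).ofReal_comp.mul_const (((a : ℂ) - b) * I)).cexp
  have hg := hu.mul ((Q.hasDerivAt (e t)).comp t he)
  have hge : ∀ s, u s * Q.eval (e s) = ‖Q.eval (e s)‖ := by
    intro s
    have h := hQ (e s) (Complex.norm_exp_ofReal_mul_I s)
    have h1 : u s * e s ^ b = e s ^ a := by
      simp only [u, e, ← Complex.exp_nat_mul, ← Complex.exp_add]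
      congr 1; ring
    refine mul_left_cancel₀ (pow_ne_zero b (Complex.exp_ne_zero (s * I))) ?_
    change e s ^ b * _ = e s ^ b * _
    rw [← h, ← h1]; ring
  have hroot' : Q.eval (e t) = 0 := hroot
  have hg' : HasDerivAt (fun s => ((‖Q.eval (e s)‖ : ℝ) : ℂ))
      (u t * (Q.derivative.eval (e t) * (e t * I))) t := by
    have h := hg.congr_of_eventuallyEq (.of_forall fun s => (hge s).symm)
    simpa only [Function.comp_apply, hroot', mul_zero, zero_add] using h
  have hre := (Complex.reCLM.hasFDerivAt.comp_hasDerivAt t hg')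
  have him := (Complex.imCLM.hasFDerivAt.comp_hasDerivAt t hg')
  have hmin : IsLocalMin (⇑Complex.reCLM ∘ fun s => ((‖Q.eval (e s)‖ : ℝ) : ℂ)) t :=
    Filter.Eventually.of_forall fun s => by simp [hroot']
  have h1 := hmin.hasDerivAt_eq_zero hre
  have h2 : Complex.imCLM (u t * (Q.derivative.eval (e t) * (e t * I))) = 0 := by
    refine him.unique ?_
    convert hasDerivAt_const t (0 : ℝ) using 1
    funext s; simp
  have h3 : u t * (Q.derivative.eval (e t) * (e t * I)) = 0 := Complex.ext h1 h2
  simpa [u, e, Complex.exp_ne_zero] using h3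

theorem eq_of_eqOn_circle_diff_singleton {f g : ℂ → ℂ} (hf : Continuous f) (hg : Continuous g)
    {r : ℂ} (h : ∀ ζ : ℂ, ‖ζ‖ = 1 → ζ ≠ r → f ζ = g ζ) {ζ : ℂ} (hζ : ‖ζ‖ = 1) : f ζ = g ζ := by
  obtain ⟨t, rfl⟩ := (Complex.norm_eq_one_iff ζ).1 hζ
  let e : ℝ → ℂ := fun s => Complex.exp (s * I)
  have he : HasDerivAt e (e t * I) t := by
    simpa [e] using ((hasDerivAt_id t).ofReal_comp.mul_const I).cexp
  have hne : ∀ᶠ s in nhdsWithin t {t}ᶜ, e s ≠ r :=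
    he.eventually_ne (mul_ne_zero (Complex.exp_ne_zero _) I_ne_zero)
  have hev : f ∘ e =ᶠ[nhdsWithin t {t}ᶜ] g ∘ e :=
    hne.mono fun s hs => h _ (Complex.norm_exp_ofReal_mul_I s) hs
  have hc : Continuous e := by fun_prop
  exact tendsto_nhds_unique_of_eventuallyEq
    ((hf.comp hc).continuousAt.tendsto.mono_left nhdsWithin_le_nhds)
    ((hg.comp hc).continuousAt.tendsto.mono_left nhdsWithin_le_nhds) hev

theorem sub_mul_dvd_of_isRoot {Q : ℂ[X]} {a b : ℕ}
    (hQ : ∀ ζ : ℂ, ‖ζ‖ = 1 → ζ ^ a * Q.eval ζ = ζ ^ b * ‖Q.eval ζ‖) {r : ℂ}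
    (hr : r ≠ 0) (hroot : Q.eval r = 0) : (X - C r) * (X - C (conj r)⁻¹) ∣ Q := by
  obtain ⟨R, rfl⟩ := dvd_iff_isRoot.2 hroot
  refine mul_dvd_mul_left _ (dvd_iff_isRoot.2 ?_)
  by_cases h : ‖r‖ = 1
  · have h1 := eval_derivative_eq_zero hQ h hroot
    rw [inv_eq_of_mul_eq_one_right (conj_mul_self_of_norm_eq_one h)]
    simpa using h1
  · have h1 := isRoot_inv_conj hQ hr hroot
    rw [eval_mul, mul_eq_zero] at h1
    refine h1.resolve_left fun h2 => h ?_
    have h3 : (conj r)⁻¹ = r := by simpa [sub_eq_zero] using h2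
    have h4 := congrArg norm h3
    rw [norm_inv, Complex.norm_conj] at h4
    have h5 : 0 < ‖r‖ := norm_pos_iff.2 hr
    field_simp at h4
    nlinarith

theorem eval_sub_mul_sub_inv_conj {r ζ : ℂ} (hr : r ≠ 0) (hζ : ‖ζ‖ = 1) :
    (ζ - r) * (ζ - (conj r)⁻¹) = -(conj r)⁻¹ * ζ * (‖ζ - r‖ : ℂ) ^ 2 := by
  have hcr : conj r ≠ 0 := (_root_.map_ne_zero _).2 hr
  have h := conj_mul_self_of_norm_eq_one hζ
  rw [← Complex.conj_mul', map_sub]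
  field_simp
  linear_combination (ζ - r) * h

/-- **Fejér–Riesz theorem**: a nonzero trigonometric polynomial `ζ ^ (a - b) * Q ζ` which is
nonnegative on the unit circle is the squared modulus of a polynomial without zeros in the open
unit disk. -/
theorem fejer_riesz (b : ℕ) (n : ℕ) : ∀ (a : ℕ) (Q : ℂ[X]), Q.natDegree = n → Q ≠ 0 →
    (∀ ζ : ℂ, ‖ζ‖ = 1 → ζ ^ a * Q.eval ζ = ζ ^ b * ‖Q.eval ζ‖) →
    ∃ p : ℂ[X], (∀ z : ℂ, ‖z‖ < 1 → p.eval z ≠ 0) ∧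
      ∀ ζ : ℂ, ‖ζ‖ = 1 → ‖p.eval ζ‖ ^ 2 = ‖Q.eval ζ‖ := by
  induction n using Nat.strong_induction_on with
  | _ n ih =>
  intro a Q hn hQ0 hQ
  rcases Nat.eq_zero_or_pos n with rfl | hpos
  · obtain ⟨c, rfl⟩ := natDegree_eq_zero.1 hn
    have hc : c ≠ 0 := by simpa using hQ0
    refine ⟨C (Real.sqrt ‖c‖ : ℂ), fun z _ => ?_, fun ζ _ => ?_⟩
    · simpa using hc
    · rw [eval_C, eval_C, norm_real, Real.norm_eq_abs, sq_abs, Real.sq_sqrt (norm_nonneg c)]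
  obtain ⟨r₀, hr₀⟩ := IsAlgClosed.exists_root Q
    fun h => hpos.ne' (hn ▸ natDegree_eq_zero_iff_degree_le_zero.2 h.le)
  by_cases h0 : Q.eval 0 = 0
  · obtain ⟨R, rfl⟩ := X_dvd_iff.2 (coeff_zero_eq_eval_zero Q ▸ h0)
    have hR0 : R ≠ 0 := right_ne_zero_of_mul hQ0
    rw [natDegree_X_mul hR0] at hn
    obtain ⟨p, hp, hpR⟩ := ih R.natDegree (by omega) (a + 1) R rfl hR0 fun ζ hζ => by
      have h := hQ ζ hζ
      simp only [eval_mul, eval_X, norm_mul, hζ, one_mul] at h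
      rw [← h]; ring
    exact ⟨p, hp, fun ζ hζ => by simp [hpR ζ hζ, hζ]⟩
  obtain ⟨r, hr, hroot⟩ : ∃ r : ℂ, 1 ≤ ‖r‖ ∧ Q.eval r = 0 := by
    have hne : r₀ ≠ 0 := by rintro rfl; exact h0 hr₀
    rcases le_total 1 ‖r₀‖ with h | h
    · exact ⟨r₀, h, hr₀⟩
    · refine ⟨_, ?_, isRoot_inv_conj hQ hne hr₀⟩
      rw [norm_inv, Complex.norm_conj]
      exact (one_le_inv₀ (norm_pos_iff.2 hne)).2 h
  have hr0 : r ≠ 0 := by rintro rfl; exact h0 hroot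
  obtain ⟨R, rfl⟩ := sub_mul_dvd_of_isRoot hQ hr0 hroot
  have hR0 : R ≠ 0 := right_ne_zero_of_mul hQ0
  have hc : -(conj r)⁻¹ ≠ 0 := neg_ne_zero.2 (inv_ne_zero ((_root_.map_ne_zero _).2 hr0))
  set S : ℂ[X] := C (-(conj r)⁻¹) * R with hS
  have hS0 : S ≠ 0 := mul_ne_zero (C_ne_zero.2 hc) hR0
  have hfac : ∀ ζ : ℂ, ‖ζ‖ = 1 →
      ((X - C r) * (X - C (conj r)⁻¹) * R).eval ζ = ζ * (‖ζ - r‖ : ℂ) ^ 2 * S.eval ζ := by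
    intro ζ hζ
    simp only [hS, eval_mul, eval_sub, eval_X, eval_C]
    rw [eval_sub_mul_sub_inv_conj hr0 hζ]; ring
  have hnorm : ∀ ζ : ℂ, ‖ζ‖ = 1 →
      ‖((X - C r) * (X - C (conj r)⁻¹) * R).eval ζ‖ = ‖ζ - r‖ ^ 2 * ‖S.eval ζ‖ := by
    intro ζ hζ
    rw [hfac ζ hζ]
    simp [hζ]
  have hdeg : S.natDegree < n := by
    rw [hS, natDegree_C_mul hc, ← hn, natDegree_mul (left_ne_zero_of_mul hQ0) hR0,
      natDegree_mul (X_sub_C_ne_zero _) (X_sub_C_ne_zero _), natDegree_X_sub_C, natDegree_X_sub_C]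
    omega
  obtain ⟨p, hp, hpS⟩ := ih S.natDegree hdeg (a + 1) S rfl hS0 fun ζ hζ => by
    refine eq_of_eqOn_circle_diff_singleton (f := fun ζ => ζ ^ (a + 1) * S.eval ζ)
      (g := fun ζ => ζ ^ b * ‖S.eval ζ‖) (r := r) (by fun_prop) (by fun_prop) ?_ hζ
    intro ζ hζ hne
    have h := hQ ζ hζ
    rw [hnorm ζ hζ, hfac ζ hζ] at h
    have h1 : (‖ζ - r‖ : ℂ) ^ 2 ≠ 0 := by simpa [sub_eq_zero] using hne
    refine mul_left_cancel₀ h1 ?_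
    push_cast at h
    linear_combination h
  refine ⟨(X - C r) * p, fun z hz => ?_, fun ζ hζ => ?_⟩
  · rw [eval_mul]
    refine mul_ne_zero ?_ (hp z hz)
    rw [eval_sub, eval_X, eval_C, sub_ne_zero]
    rintro rfl
    linarith
  · rw [hnorm ζ hζ, ← hpS ζ hζ, eval_mul, norm_mul, mul_pow, eval_sub, eval_X, eval_C]

theorem stmt_4 (p₁ p₂ : Polynomial ℂ)
    (hp₂ : ∀ z : ℂ, ‖z‖ ≤ 1 → p₂.eval z ≠ 0)
    (hle : ∀ ζ : ℂ, ‖ζ‖ = 1 → ‖p₁.eval ζ‖ ≤ ‖p₂.eval ζ‖)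
    (hstrict : ∃ ζ : ℂ, ‖ζ‖ = 1 ∧ ‖p₁.eval ζ‖ < ‖p₂.eval ζ‖) :
    ∃ p : Polynomial ℂ, (∀ z : ℂ, ‖z‖ < 1 → p.eval z ≠ 0) ∧
      ∀ ζ : ℂ, ‖ζ‖ = 1 → ‖p.eval ζ‖ ^ 2 = ‖p₂.eval ζ‖ ^ 2 - ‖p₁.eval ζ‖ ^ 2 := by
  set N := max p₁.natDegree p₂.natDegree
  set Q : ℂ[X] := p₂ * conjReflect N p₂ - p₁ * conjReflect N p₁ with hQdef
  have hQ : ∀ ζ : ℂ, ‖ζ‖ = 1 →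
      Q.eval ζ = ζ ^ N * ((‖p₂.eval ζ‖ ^ 2 - ‖p₁.eval ζ‖ ^ 2 : ℝ) : ℂ) := by
    intro ζ hζ
    rw [hQdef, eval_sub, eval_mul, eval_mul,
      eval_conjReflect_of_norm_eq_one (le_max_left _ _) hζ,
      eval_conjReflect_of_norm_eq_one (le_max_right _ _) hζ]
    push_cast
    rw [← Complex.conj_mul', ← Complex.conj_mul']
    ring
  have hnorm : ∀ ζ : ℂ, ‖ζ‖ = 1 → ‖Q.eval ζ‖ = ‖p₂.eval ζ‖ ^ 2 - ‖p₁.eval ζ‖ ^ 2 := by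
    intro ζ hζ
    rw [hQ ζ hζ, norm_mul, norm_pow, hζ, one_pow, one_mul, norm_real, Real.norm_of_nonneg]
    exact sub_nonneg.2 (pow_le_pow_left₀ (norm_nonneg _) (hle ζ hζ) 2)
  have hQ0 : Q ≠ 0 := by
    intro h
    obtain ⟨ζ, hζ, hlt⟩ := hstrict
    have h1 := hnorm ζ hζ
    rw [h, eval_zero, norm_zero] at h1
    linarith [pow_lt_pow_left₀ hlt (norm_nonneg _) two_ne_zero]
  obtain ⟨p, hp, hpQ⟩ := fejer_riesz N _ 0 Q rfl hQ0 fun ζ hζ => by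
    rw [pow_zero, one_mul, hnorm ζ hζ, hQ ζ hζ]
  exact ⟨p, hp, fun ζ hζ => (hpQ ζ hζ).trans (hnorm ζ hζ)⟩
end

section
/- Let w(θ) = Σ_{j=-n}^{n} c_j e^{ijθ} be a trigonometric polynomial that is nonnegative for all real θ and not identically zero. Then there exists a polynomial p of degree at most n with complex coefficients, having no zeros in the open unit disk, such that w(θ) = |p(e^{iθ})|² for all θ. -/
open Complex Polynomial

open scoped ComplexOrder ComplexConjugate Topology

lemma preperfect_unit_sphere : Preperfect (Metric.sphere (0 : ℂ) 1) := by
  refine (isPreconnected_sphere (by simp) 0 1).preperfect_of_nontrivial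
    ⟨1, by simp, -1, by simp, ?_⟩
  norm_num [Complex.ext_iff]

lemma infinite_unit_sphere : (Metric.sphere (0 : ℂ) 1).Infinite :=
  (isPreconnected_sphere (by simp) 0 1).infinite_of_nontrivial
    ⟨1, by simp, -1, by simp, by norm_num [Complex.ext_iff]⟩

lemma mul_conj_eq_one_of_norm_eq_one {z : ℂ} (hz : ‖z‖ = 1) : z * conj z = 1 := by
  rw [Complex.mul_conj, Complex.normSq_eq_norm_sq, hz]; norm_num

/-- A polynomial that is real on the unit circle after multiplication by `conj z ^ n` is
self-reciprocal. -/
lemma eq_reflect_map_conj {n : ℕ} {P : ℂ[X]} (hdeg : P.natDegree ≤ 2 * n)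
    (hP : ∀ z : ℂ, ‖z‖ = 1 → 0 ≤ P.eval z * conj z ^ n) :
    P = reflect (2 * n) (P.map (starRingEnd ℂ)) := by
  refine Polynomial.eq_of_infinite_eval_eq _ _ (infinite_unit_sphere.mono fun z hz => ?_)
  have hz1 : ‖z‖ = 1 := by simpa using hz
  have hzc := mul_conj_eq_one_of_norm_eq_one hz1
  have hreal : conj (P.eval z * conj z ^ n) = P.eval z * conj z ^ n :=
    Complex.conj_eq_iff_im.2 (Complex.nonneg_iff.1 (hP z hz1)).2.symm
  let _ : Invertible (conj z) := ⟨z, hzc, by rw [mul_comm]; exact hzc⟩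
  have hrefl := eval₂_reflect_mul_pow (RingHom.id ℂ) (conj z) (2 * n)
    (P.map (starRingEnd ℂ)) (natDegree_map_le.trans hdeg)
  have hinv : ⅟(conj z) = z := rfl
  rw [hinv, ← eval, ← eval, eval_map, eval₂_hom] at hrefl
  simp only [map_mul, map_pow, Complex.conj_conj] at hreal
  have hzn : z ^ n * conj z ^ n = 1 := by rw [← mul_pow, hzc, one_pow]
  change P.eval z = (reflect (2 * n) (P.map (starRingEnd ℂ))).eval z
  linear_combination -P.eval z * hzn - z ^ n * hreal - z ^ (2 * n) * hrefl +
    (reflect (2 * n) (P.map (starRingEnd ℂ))).eval z * (z ^ n * conj z ^ n + 1) * hzn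

lemma isRoot_inv_conj_s5 {n : ℕ} {P : ℂ[X]} (hdeg : P.natDegree ≤ 2 * n)
    (hP : ∀ z : ℂ, ‖z‖ = 1 → 0 ≤ P.eval z * conj z ^ n)
    {a : ℂ} (ha : a ≠ 0) (hroot : P.eval a = 0) : P.eval (conj a)⁻¹ = 0 := by
  have hca : conj a ≠ 0 := by simpa using ha
  let _ := invertibleOfNonzero hca
  have hrefl := eval₂_reflect_mul_pow (RingHom.id ℂ) (conj a) (2 * n)
    (P.map (starRingEnd ℂ)) (natDegree_map_le.trans hdeg)
  rw [← eq_reflect_map_conj hdeg hP, invOf_eq_inv] at hrefl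
  have h0 : eval₂ (RingHom.id ℂ) (conj a) (P.map (starRingEnd ℂ)) = 0 := by
    change (P.map (starRingEnd ℂ)).eval (conj a) = 0
    rw [eval_map_apply, hroot, map_zero]
  rw [h0] at hrefl
  exact (mul_eq_zero.1 hrefl).resolve_right (pow_ne_zero _ hca)

/-- A zero on the unit circle is a minimum of the nonnegative function `P z * conj z ^ n`, hence
a critical point. -/
lemma eval_derivative_eq_zero_of_norm_eq_one {n : ℕ} {P : ℂ[X]}
    (hP : ∀ z : ℂ, ‖z‖ = 1 → 0 ≤ P.eval z * conj z ^ n)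
    {a : ℂ} (ha : ‖a‖ = 1) (hroot : P.eval a = 0) : P.derivative.eval a = 0 := by
  have hγ : HasDerivAt (fun t : ℝ => a * Complex.exp (t * I)) (a * I) 0 := by
    have h := (((hasDerivAt_id (0 : ℝ)).ofReal_comp.mul_const I).cexp.const_mul a)
    simpa using h
  have hP' : HasDerivAt (fun t : ℝ => P.eval (a * Complex.exp (t * I)))
      (P.derivative.eval a * (a * I)) 0 := by
    have h := (P.hasDerivAt (a * Complex.exp ((0 : ℝ) * I))).comp (0 : ℝ) hγ
    simpa [Function.comp_def] using h
  have hf := hP'.mul (hγ.star.pow n)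
  set f : ℝ → ℂ := fun t => P.eval (a * Complex.exp (t * I)) *
    conj (a * Complex.exp (t * I)) ^ n with hfdef
  have hf' : HasDerivAt f (P.derivative.eval a * (a * I) * conj a ^ n) 0 := by
    refine hf.congr_deriv ?_
    simp [hroot]
  have hnonneg : ∀ t, 0 ≤ f t := fun t => hP _ (by simp [ha, Complex.norm_exp_ofReal_mul_I])
  have hf0 : f 0 = 0 := by simp [hfdef, hroot]
  have hre : (P.derivative.eval a * (a * I) * conj a ^ n).re = 0 := by
    refine IsLocalMin.hasDerivAt_eq_zero (f := fun t => (f t).re) (a := 0)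
      (Filter.Eventually.of_forall fun t => ?_)
      (Complex.reCLM.hasFDerivAt.comp_hasDerivAt (0 : ℝ) hf')
    simpa [hf0] using (Complex.nonneg_iff.1 (hnonneg t)).1
  have him : (P.derivative.eval a * (a * I) * conj a ^ n).im = 0 := by
    refine IsLocalMin.hasDerivAt_eq_zero (f := fun t => (f t).im) (a := 0)
      (Filter.Eventually.of_forall fun t => ?_)
      (Complex.imCLM.hasFDerivAt.comp_hasDerivAt (0 : ℝ) hf')
    simpa [hf0] using (Complex.nonneg_iff.1 (hnonneg t)).2.le
  have ha0 : a ≠ 0 := by rintro rfl; simp at ha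
  simpa [ha0] using Complex.ext (w := 0) hre him

lemma nonneg_on_unit_circle_of_ne {n : ℕ} {Q : ℂ[X]} (a : ℂ)
    (hQ : ∀ z : ℂ, ‖z‖ = 1 → z ≠ a → 0 ≤ Q.eval z * conj z ^ n) :
    ∀ z : ℂ, ‖z‖ = 1 → 0 ≤ Q.eval z * conj z ^ n := by
  intro z hz
  by_cases hza : z = a
  swap
  · exact hQ z hz hza
  subst hza
  have hacc : (𝓝[≠] z ⊓ Filter.principal (Metric.sphere (0 : ℂ) 1)).NeBot :=
    preperfect_unit_sphere z (by simpa using hz)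
  have hcont : Continuous fun x : ℂ => Q.eval x * conj x ^ n := by fun_prop
  refine ge_of_tendsto (hcont.continuousAt.tendsto.mono_left
    (inf_le_left.trans nhdsWithin_le_nhds)
    : Filter.Tendsto _ (𝓝[≠] z ⊓ Filter.principal (Metric.sphere (0 : ℂ) 1)) _) ?_
  filter_upwards [Filter.mem_inf_of_left self_mem_nhdsWithin,
    Filter.mem_inf_of_right (Filter.mem_principal_self _)] with x hx hx'
  exact hQ x (by simpa using hx') hx

lemma exists_eq_X_sub_C_mul_mul {n : ℕ} {P : ℂ[X]} (hdeg : P.natDegree ≤ 2 * n)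
    (hP : ∀ z : ℂ, ‖z‖ = 1 → 0 ≤ P.eval z * conj z ^ n)
    {a : ℂ} (ha : a ≠ 0) (hroot : P.eval a = 0) :
    ∃ Q : ℂ[X], P = (X - C a) * ((X - C (conj a)⁻¹) * Q) := by
  obtain ⟨R, hR⟩ := dvd_iff_isRoot.2 hroot
  suffices hRroot : R.eval (conj a)⁻¹ = 0 by
    obtain ⟨Q, rfl⟩ := dvd_iff_isRoot.2 hRroot
    exact ⟨Q, hR⟩
  by_cases hab : (conj a)⁻¹ = a
  · have ha1 : ‖a‖ = 1 := by
      have h : ‖a‖⁻¹ = ‖a‖ := by simpa using congrArg norm hab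
      have h0 : ‖a‖ ≠ 0 := norm_ne_zero_iff.2 ha
      have h2 : ‖a‖ * ‖a‖ = 1 := by nth_rewrite 1 [← h]; exact inv_mul_cancel₀ h0
      nlinarith [norm_nonneg a]
    have hd := eval_derivative_eq_zero_of_norm_eq_one hP ha1 hroot
    rw [hab]
    simpa [hR] using hd
  · have hb := isRoot_inv_conj_s5 hdeg hP ha hroot
    rw [hR, eval_mul] at hb
    exact (mul_eq_zero.1 hb).resolve_left (by simpa [sub_eq_zero] using hab)

/-- The algebraic form of the Fejér–Riesz theorem. -/
theorem exists_eval_mul_conj_pow_eq_norm_sq (n : ℕ) : ∀ P : ℂ[X], P ≠ 0 →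
    P.natDegree ≤ 2 * n → (∀ z : ℂ, ‖z‖ = 1 → 0 ≤ P.eval z * conj z ^ n) →
    ∃ p : ℂ[X], p.natDegree ≤ n ∧ (∀ z : ℂ, ‖z‖ < 1 → p.eval z ≠ 0) ∧
      ∀ z : ℂ, ‖z‖ = 1 → P.eval z * conj z ^ n = ((‖p.eval z‖ ^ 2 : ℝ) : ℂ) := by
  induction n with
  | zero =>
    intro P hne hdeg hP
    obtain ⟨c, rfl⟩ := natDegree_eq_zero.1 (Nat.le_zero.1 hdeg)
    have hc : c ≠ 0 := by simpa using hne
    obtain ⟨r, hr, rfl⟩ : ∃ r : ℝ, 0 ≤ r ∧ (r : ℂ) = c := by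
      have h : 0 ≤ c := by simpa using hP 1 (by simp)
      exact ⟨c.re, (Complex.nonneg_iff.1 h).1,
        Complex.ext rfl (by simpa using (Complex.nonneg_iff.1 h).2)⟩
    have hr0 : r ≠ 0 := by simpa using hc
    refine ⟨C (Real.sqrt r : ℂ), by simp, fun z _ => ?_, fun z _ => ?_⟩
    · simpa using (Real.sqrt_ne_zero hr).2 hr0
    · simp [abs_of_nonneg (Real.sqrt_nonneg r), Real.sq_sqrt hr]
  | succ n ih =>
    intro P hne hdeg hP
    by_cases h0 : P.eval 0 = 0
    · have hX : X ∣ P := X_dvd_iff.2 (by rwa [coeff_zero_eq_eval_zero])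
      obtain ⟨Q, rfl⟩ := hX
      have hQ : Q ≠ 0 := right_ne_zero_of_mul hne
      have htop : (X * Q).coeff (2 * (n + 1)) = 0 := by
        rw [eq_reflect_map_conj hdeg hP, coeff_reflect, revAt_le le_rfl]
        simp
      have hQdeg : Q.natDegree ≤ 2 * n := by
        have hle : (X * Q).natDegree ≠ 2 * (n + 1) := fun h => by
          rw [← h, coeff_natDegree, leadingCoeff_eq_zero] at htop
          exact hne htop
        rw [natDegree_X_mul hQ] at hdeg hle
        omega
      have heq : ∀ z : ℂ, ‖z‖ = 1 →
          (X * Q).eval z * conj z ^ (n + 1) = Q.eval z * conj z ^ n := fun z hz => by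
        rw [eval_mul, eval_X]
        linear_combination Q.eval z * conj z ^ n * mul_conj_eq_one_of_norm_eq_one hz
      obtain ⟨p, hp, hp', hp''⟩ := ih Q hQ hQdeg fun z hz => heq z hz ▸ hP z hz
      exact ⟨p, hp.trans n.le_succ, hp', fun z hz => (heq z hz).trans (hp'' z hz)⟩
    · obtain ⟨a, ha1, hroot⟩ : ∃ a : ℂ, 1 ≤ ‖a‖ ∧ P.eval a = 0 := by
        have hpos : P.degree ≠ 0 := fun h => by
          have hc := eq_reflect_map_conj hdeg hP
          have h1 : P.coeff (2 * (n + 1)) = 0 :=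
            coeff_eq_zero_of_natDegree_lt (by rw [natDegree_eq_of_degree_eq_some (n := 0) h]; omega)
          rw [hc, coeff_reflect, revAt_le le_rfl] at h1
          simp [coeff_zero_eq_eval_zero, h0] at h1
        obtain ⟨a, ha⟩ := Complex.isAlgClosed.exists_root P hpos
        have ha0 : a ≠ 0 := by rintro rfl; exact h0 ha
        rcases le_total 1 ‖a‖ with h | h
        · exact ⟨a, h, ha⟩
        · refine ⟨(conj a)⁻¹, ?_, isRoot_inv_conj_s5 hdeg hP ha0 ha⟩
          simpa using (one_le_inv₀ (norm_pos_iff.2 ha0)).2 h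
      have ha0 : a ≠ 0 := by rintro rfl; exact h0 hroot
      have hca0 : conj a ≠ 0 := by simpa using ha0
      obtain ⟨Q, hPQ⟩ := exists_eq_X_sub_C_mul_mul hdeg hP ha0 hroot
      have hQ : Q ≠ 0 := by rintro rfl; simp [hPQ] at hne
      have hQdeg : Q.natDegree ≤ 2 * n := by
        rw [hPQ, natDegree_mul (X_sub_C_ne_zero _) (mul_ne_zero (X_sub_C_ne_zero _) hQ),
          natDegree_mul (X_sub_C_ne_zero _) hQ, natDegree_X_sub_C, natDegree_X_sub_C] at hdeg
        omega
      have heq : ∀ z : ℂ, ‖z‖ = 1 → P.eval z * conj z ^ (n + 1) =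
          ((‖z - a‖ ^ 2 : ℝ) : ℂ) * ((C (-(conj a)⁻¹) * Q).eval z * conj z ^ n) := by
        intro z hz
        rw [← Complex.normSq_eq_norm_sq, ← Complex.mul_conj, hPQ]
        simp only [eval_mul, eval_sub, eval_X, eval_C, map_sub]
        have hzc := mul_conj_eq_one_of_norm_eq_one hz
        have hb : conj a * (conj a)⁻¹ = 1 := mul_inv_cancel₀ hca0
        linear_combination (z - a) * Q.eval z * conj z ^ n * (hzc - hb)
      have hnonneg : ∀ z : ℂ, ‖z‖ = 1 →
          0 ≤ (C (-(conj a)⁻¹) * Q).eval z * conj z ^ n := by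
        refine nonneg_on_unit_circle_of_ne a fun z hz hza => ?_
        have hpos : (0 : ℂ) < ((‖z - a‖ ^ 2 : ℝ) : ℂ) :=
          Complex.zero_lt_real.2 (pow_pos (norm_pos_iff.2 (sub_ne_zero.2 hza)) 2)
        have h := mul_nonneg (inv_nonneg.2 hpos.le) (heq z hz ▸ hP z hz)
        rwa [inv_mul_cancel_left₀ hpos.ne'] at h
      obtain ⟨q, hq, hq', hq''⟩ := ih (C (-(conj a)⁻¹) * Q)
        (mul_ne_zero (by simpa using ha0) hQ) ((natDegree_C_mul_le _ _).trans hQdeg) hnonneg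
      refine ⟨(X - C a) * q, ?_, fun z hz => ?_, fun z hz => ?_⟩
      · refine natDegree_mul_le.trans ?_
        rw [natDegree_X_sub_C]
        omega
      · rw [eval_mul]
        refine mul_ne_zero ?_ (hq' z hz)
        rw [eval_sub, eval_X, eval_C, sub_ne_zero]
        rintro rfl
        exact absurd hz ha1.not_gt
      · rw [heq z hz, hq'' z hz]
        simp [mul_pow]

theorem stmt_5 (n : ℕ) (c : ℤ → ℂ)
    (w : ℝ → ℂ)
    (hw : ∀ θ : ℝ, w θ = ∑ j ∈ Finset.Icc (-(n : ℤ)) (n : ℤ),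
      c j * Complex.exp (Complex.I * (j : ℂ) * (θ : ℂ)))
    (hreal : ∀ θ : ℝ, (w θ).im = 0)
    (hnonneg : ∀ θ : ℝ, 0 ≤ (w θ).re)
    (hne : ∃ θ : ℝ, w θ ≠ 0) :
    ∃ p : Polynomial ℂ, p.natDegree ≤ n ∧
      (∀ z : ℂ, ‖z‖ < 1 → p.eval z ≠ 0) ∧
      ∀ θ : ℝ, w θ = ((‖p.eval (Complex.exp (Complex.I * (θ : ℂ)))‖ ^ 2 : ℝ) : ℂ) := by
  set P : ℂ[X] := ∑ j ∈ Finset.range (2 * n + 1), C (c ((j : ℤ) - n)) * X ^ j with hPdef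
  have hwP : ∀ θ : ℝ, P.eval (Complex.exp (Complex.I * θ)) *
      conj (Complex.exp (Complex.I * θ)) ^ n = w θ := by
    intro θ
    rw [hw, hPdef, eval_finsetSum, Finset.sum_mul]
    refine Finset.sum_nbij' (fun j => (j : ℤ) - n) (fun j => (j + n).toNat) ?_ ?_ ?_ ?_ ?_
    · intro j hj; simp only [Finset.mem_range, Finset.mem_Icc] at hj ⊢; omega
    · intro j hj; simp only [Finset.mem_range, Finset.mem_Icc] at hj ⊢; omega
    · intro j hj; simp
    · intro j hj; simp only [Finset.mem_Icc] at hj; omega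
    · intro j hj
      rw [eval_C_mul, eval_pow, eval_X, ← Complex.exp_conj, ← Complex.exp_nat_mul,
        ← Complex.exp_nat_mul, mul_assoc, ← Complex.exp_add]
      congr 2
      simp only [map_mul, Complex.conj_I, Complex.conj_ofReal]
      push_cast
      ring
  have hdeg : P.natDegree ≤ 2 * n := natDegree_sum_le_of_forall_le _ _ fun j hj =>
    (natDegree_C_mul_X_pow_le _ _).trans (Nat.lt_succ_iff.1 (Finset.mem_range.1 hj))
  have hne' : P ≠ 0 := by
    intro h
    obtain ⟨θ, hθ⟩ := hne
    exact hθ (by rw [← hwP, h, eval_zero, zero_mul])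
  have hP : ∀ z : ℂ, ‖z‖ = 1 → 0 ≤ P.eval z * conj z ^ n := by
    intro z hz
    have hzarg : Complex.exp (Complex.I * (z.arg : ℂ)) = z := by
      simpa [hz, mul_comm] using Complex.norm_mul_exp_arg_mul_I z
    rw [← hzarg, hwP]
    exact Complex.nonneg_iff.2 ⟨hnonneg _, (hreal _).symm⟩
  obtain ⟨p, hp, hp', hp''⟩ := exists_eval_mul_conj_pow_eq_norm_sq n P hne' hdeg hP
  refine ⟨p, hp, hp', fun θ => ?_⟩
  rw [← hwP, hp'' _ (by rw [mul_comm, Complex.norm_exp_ofReal_mul_I])]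
end
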